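/- arXiv:2507.08543 — 4 statements merged into one kernel-verified Lean document; each statement's English description precedes it below -/
import Mathlib

section
/- Let x⁽⁰⁾ ∈ D and δ ≥ 0. Suppose the iterates satisfy: for each t ≥ 0, γ_t = 2/(t+2), s_t ∈ D with ⟨s_t, ∇f(x⁽ᵗ⁾)⟩ ≤ min_{ŝ ∈ D} ⟨ŝ, ∇f(x⁽ᵗ⁾)⟩ + (δ/2)·γ_t·C_f, and x⁽ᵗ⁺¹⁾ = (1 − γ_t)·x⁽ᵗ⁾ + γ_t·s_t. Then for every t ≥ 1, f(x⁽ᵗ⁾) − f(x*) ≤ (2·C_f/(t+2))·(1 + δ). -/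
open scoped RealInnerProductSpace

/-- A convex function lies above its tangent hyperplanes. -/
theorem ConvexOn.add_inner_gradient_le {E : Type*} [NormedAddCommGroup E]
    [InnerProductSpace ℝ E] [CompleteSpace E] {f : E → ℝ} {x g : E}
    (hf : ConvexOn ℝ Set.univ f) (hg : HasGradientAt f g x) (y : E) :
    f x + ⟪y - x, g⟫ ≤ f y := by
  have hline : ConvexOn ℝ Set.univ (f ∘ AffineMap.lineMap (k := ℝ) x y) := by
    simpa using hf.comp_affineMap (AffineMap.lineMap (k := ℝ) x y)
  have hderiv : HasDerivAt (f ∘ AffineMap.lineMap (k := ℝ) x y) ⟪g, y - x⟫ 0 := by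
    have h := hg.hasFDerivAt
    rw [← AffineMap.lineMap_apply_zero (k := ℝ) x y] at h
    simpa using h.comp_hasDerivAt (0 : ℝ) AffineMap.hasDerivAt_lineMap
  have h := hline.le_slope_of_hasDerivAt (Set.mem_univ 0) (Set.mem_univ 1) zero_lt_one hderiv
  simp only [slope_def_field, Function.comp_apply, AffineMap.lineMap_apply_zero,
    AffineMap.lineMap_apply_one, sub_zero, div_one] at h
  rw [real_inner_comm]
  linarith

/-- The recursion `h (t + 1) ≤ (1 - γ) * h t + γ ^ 2 * C` with step size `γ = 2 / (t + 2)`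
forces decay at rate `4 * C / (t + 2)`. -/
theorem le_four_mul_div_of_recursion {h : ℕ → ℝ} {C : ℝ} (hC : 0 ≤ C)
    (hrec : ∀ t : ℕ,
      h (t + 1) ≤ (1 - 2 / ((t : ℝ) + 2)) * h t + (2 / ((t : ℝ) + 2)) ^ 2 * C)
    {t : ℕ} (ht : 1 ≤ t) : h t ≤ 4 * C / ((t : ℝ) + 2) := by
  induction t, ht using Nat.le_induction with
  | base =>
    have := hrec 0
    norm_num at this ⊢
    linarith
  | succ t _ ih =>
    have hγ : (0 : ℝ) ≤ 1 - 2 / ((t : ℝ) + 2) := by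
      rw [sub_nonneg, div_le_one (by positivity)]
      linarith [t.cast_nonneg (α := ℝ)]
    calc h (t + 1)
        ≤ (1 - 2 / ((t : ℝ) + 2)) * (4 * C / ((t : ℝ) + 2)) + (2 / ((t : ℝ) + 2)) ^ 2 * C := by
          grw [hrec t, ih]
      _ = 4 * C * ((t : ℝ) + 1) / ((t : ℝ) + 2) ^ 2 := by
          field_simp
          ring
      _ ≤ 4 * C / (((t + 1 : ℕ) : ℝ) + 2) := by
          rw [div_le_div_iff₀ (by positivity) (by positivity)]
          push_cast
          nlinarith

theorem frank_wolfe_convergence {d : ℕ}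
    (f : EuclideanSpace ℝ (Fin d) → ℝ)
    (f' : EuclideanSpace ℝ (Fin d) → EuclideanSpace ℝ (Fin d))
    (D : Set (EuclideanSpace ℝ (Fin d)))
    (hDne : D.Nonempty) (hDcp : IsCompact D) (hDcv : Convex ℝ D)
    (hconv : ConvexOn ℝ Set.univ f)
    (hgrad : ∀ x, HasGradientAt f (f' x) x)
    (Cf : ℝ) (hCf : 0 ≤ Cf)
    (hcurv : ∀ x ∈ D, ∀ s ∈ D, ∀ β ∈ Set.Icc (0:ℝ) 1,
      f (x + β • (s - x)) ≤ f x + β * ⟪s - x, f' x⟫ + β ^ 2 / 2 * Cf)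
    (xstar : EuclideanSpace ℝ (Fin d)) (hxstar : xstar ∈ D)
    (hmin : ∀ z ∈ D, f xstar ≤ f z)
    (δ : ℝ) (hδ : 0 ≤ δ)
    (x s : ℕ → EuclideanSpace ℝ (Fin d))
    (hx0 : x 0 ∈ D) (hs : ∀ t, s t ∈ D)
    (hlin : ∀ t : ℕ, ∀ shat ∈ D,
      ⟪s t, f' (x t)⟫ ≤ ⟪shat, f' (x t)⟫ + δ / 2 * (2 / ((t : ℝ) + 2)) * Cf)
    (hupd : ∀ t : ℕ,
      x (t + 1) = (1 - 2 / ((t : ℝ) + 2)) • x t + (2 / ((t : ℝ) + 2)) • s t) :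
    ∀ t : ℕ, 1 ≤ t → f (x t) - f xstar ≤ 2 * Cf / ((t : ℝ) + 2) * (1 + δ) := by
  intro t ht
  have hγ0 (t : ℕ) : (0 : ℝ) ≤ 2 / ((t : ℝ) + 2) := by positivity
  have hγ1 (t : ℕ) : 2 / ((t : ℝ) + 2) ≤ 1 := by
    rw [div_le_one (by positivity)]
    linarith [t.cast_nonneg (α := ℝ)]
  have hx (t : ℕ) : x t ∈ D := by
    induction t with
    | zero => exact hx0
    | succ t ih =>
      rw [hupd]
      exact hDcv ih (hs t) (sub_nonneg.2 (hγ1 t)) (hγ0 t) (sub_add_cancel _ _)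
  have hrec (t : ℕ) : f (x (t + 1)) - f xstar ≤
      (1 - 2 / ((t : ℝ) + 2)) * (f (x t) - f xstar)
        + (2 / ((t : ℝ) + 2)) ^ 2 * (Cf * (1 + δ) / 2) := by
    have hstep := hcurv (x t) (hx t) (s t) (hs t) _ ⟨hγ0 t, hγ1 t⟩
    have hpoint : x t + (2 / ((t : ℝ) + 2)) • (s t - x t) = x (t + 1) := by
      rw [hupd]
      module
    have htangent := hconv.add_inner_gradient_le (hgrad (x t)) xstar
    have horacle := hlin t xstar hxstar
    rw [hpoint, inner_sub_left] at hstep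
    rw [inner_sub_left] at htangent
    have hdir : ⟪s t, f' (x t)⟫ - ⟪x t, f' (x t)⟫ ≤
        f xstar - f (x t) + δ / 2 * (2 / ((t : ℝ) + 2)) * Cf := by
      linarith
    linarith [mul_le_mul_of_nonneg_left hdir (hγ0 t)]
  have hC : 0 ≤ Cf * (1 + δ) / 2 := by positivity
  calc f (x t) - f xstar ≤ 4 * (Cf * (1 + δ) / 2) / ((t : ℝ) + 2) :=
        le_four_mul_div_of_recursion (h := fun t => f (x t) - f xstar) hC hrec ht
    _ = 2 * Cf / ((t : ℝ) + 2) * (1 + δ) := by ring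
end

section
/- Assume d ≥ 1, L > 0, C_f > 0, and D = {x ∈ ℝ^d : ‖x‖₁ ≤ 1}. Let x⁽⁰⁾ ∈ D, and for each t ≥ 0 set γ_t = 2/(t+2) and σ_t = C_f/(√d·L·(t+2)). Suppose s_t ∈ D satisfies ⟨s_t, ∇f(x⁽ᵗ⁾)⟩ ≤ −‖∇f(x⁽ᵗ⁾)‖_∞ + √d·L·σ_t, and set x⁽ᵗ⁺¹⁾ = (1 − γ_t)·x⁽ᵗ⁾ + γ_t·s_t. Then f(x⁽ᵗ⁾) − f(x*) ≤ 4·C_f/(t+2) for all t ≥ 1; in particular, f(x⁽ᵀ⁾) − f(x*) ≤ ε for any ε > 0 and any integer T ≥ 4·C_f/ε − 2. -/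
open scoped RealInnerProductSpace

/-- First-order characterization of convexity: the tangent at `x` lies below the graph. -/
theorem ConvexOn.add_inner_le_of_hasGradientAt {E : Type*} [NormedAddCommGroup E]
    [InnerProductSpace ℝ E] [CompleteSpace E] {f : E → ℝ} {g x : E}
    (hf : ConvexOn ℝ Set.univ f) (hg : HasGradientAt f g x) (y : E) :
    f x + ⟪y - x, g⟫ ≤ f y := by
  have hc : ConvexOn ℝ Set.univ (f ∘ AffineMap.lineMap (k := ℝ) x y) := by
    simpa using hf.comp_affineMap (AffineMap.lineMap (k := ℝ) x y)
  have hline : HasDerivAt (AffineMap.lineMap (k := ℝ) x y) (y - x) (0 : ℝ) :=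
    AffineMap.hasDerivAt_lineMap
  have hg' : HasFDerivAt f (InnerProductSpace.toDual ℝ E g)
      (AffineMap.lineMap (k := ℝ) x y (0 : ℝ)) := by
    simpa using hg.hasFDerivAt
  have hd := hg'.comp_hasDerivAt (0 : ℝ) hline
  have h := hc.le_slope_of_hasDerivAt (Set.mem_univ 0) (Set.mem_univ 1) one_pos hd
  simp only [slope_def_field, Function.comp_apply, AffineMap.lineMap_apply_one,
    AffineMap.lineMap_apply_zero, sub_zero, div_one, InnerProductSpace.toDual_apply_apply] at h
  rw [real_inner_comm] at h
  linarith

/-- The inner product with a point of the unit `ℓ¹` ball is at least minus the `ℓ∞` norm. -/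
theorem EuclideanSpace.neg_iSup_abs_le_inner {ι : Type*} [Fintype ι]
    {z : EuclideanSpace ℝ ι} (hz : ∑ i, |z i| ≤ 1) (g : EuclideanSpace ℝ ι) :
    -(⨆ j, |g j|) ≤ ⟪z, g⟫ := by
  have hle : ∀ i, |g i| ≤ ⨆ j, |g j| := le_ciSup (Set.finite_range _).bddAbove
  have hnonneg : 0 ≤ ⨆ j, |g j| := Real.iSup_nonneg fun _ => abs_nonneg _
  refine neg_le_of_abs_le ?_
  calc |⟪z, g⟫| ≤ ∑ i, |z i| * |g i| := by
        rw [PiLp.inner_apply]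
        refine (Finset.abs_sum_le_sum_abs _ _).trans (le_of_eq ?_)
        simp [abs_mul, mul_comm]
    _ ≤ ∑ i, |z i| * ⨆ j, |g j| := by gcongr with i; exact hle i
    _ = (∑ i, |z i|) * ⨆ j, |g j| := by rw [Finset.sum_mul]
    _ ≤ ⨆ j, |g j| := mul_le_of_le_one_left hnonneg hz

/-- The unit `ℓ¹` ball is convex. -/
theorem EuclideanSpace.convex_setOf_sum_abs_le_one {ι : Type*} [Fintype ι] :
    Convex ℝ {x : EuclideanSpace ℝ ι | ∑ i, |x i| ≤ 1} := by
  intro x hx y hy a b ha hb hab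
  simp only [Set.mem_ofPred_eq] at hx hy ⊢
  calc ∑ i, |(a • x + b • y) i| ≤ ∑ i, (a * |x i| + b * |y i|) := by
        gcongr with i
        refine (abs_add_le _ _).trans (le_of_eq ?_)
        simp [abs_mul, abs_of_nonneg ha, abs_of_nonneg hb]
    _ = a * ∑ i, |x i| + b * ∑ i, |y i| := by
        rw [Finset.sum_add_distrib, Finset.mul_sum, Finset.mul_sum]
    _ ≤ 1 := by nlinarith

/-- The Frank–Wolfe gap recursion with steps `2 / (t + 2)` gives a `4 C / (t + 2)` rate. -/
theorem le_four_mul_div_of_frankWolfe_recursion {C : ℝ} (hC : 0 ≤ C) {h : ℕ → ℝ}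
    (hrec : ∀ t : ℕ, h (t + 1) ≤ (1 - 2 / ((t : ℝ) + 2)) * h t + 4 * C / ((t : ℝ) + 2) ^ 2)
    {t : ℕ} (ht : 1 ≤ t) : h t ≤ 4 * C / ((t : ℝ) + 2) := by
  induction t, ht using Nat.le_induction with
  | base =>
    have := hrec 0
    norm_num at this ⊢
    linarith
  | succ t _ ih =>
    have hcoef : 1 - 2 / ((t : ℝ) + 2) = t / ((t : ℝ) + 2) := by field_simp; ring
    calc h (t + 1) ≤ (1 - 2 / ((t : ℝ) + 2)) * h t + 4 * C / ((t : ℝ) + 2) ^ 2 := hrec t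
      _ ≤ t / ((t : ℝ) + 2) * (4 * C / ((t : ℝ) + 2)) + 4 * C / ((t : ℝ) + 2) ^ 2 := by
        rw [hcoef]; gcongr
      _ = 4 * C * ((t + 1) / ((t : ℝ) + 2) ^ 2) := by field_simp
      _ ≤ 4 * C * (1 / ((t : ℝ) + 3)) := by
        refine mul_le_mul_of_nonneg_left ?_ (by positivity)
        rw [div_le_div_iff₀ (by positivity) (by positivity)]
        nlinarith
      _ = 4 * C / (((t + 1 : ℕ) : ℝ) + 2) := by push_cast; ring


theorem quantum_frank_wolfe_l1_ball {d : ℕ} (hd : 1 ≤ d)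
    (L Cf : ℝ) (hL : 0 < L) (hCf : 0 < Cf)
    (f : EuclideanSpace ℝ (Fin d) → ℝ)
    (f' : EuclideanSpace ℝ (Fin d) → EuclideanSpace ℝ (Fin d))
    (hconv : ConvexOn ℝ Set.univ f)
    (hgrad : ∀ x, HasGradientAt f (f' x) x)
    (hlip : ∀ x y, ‖f' x - f' y‖ ≤ L * ‖x - y‖)
    (D : Set (EuclideanSpace ℝ (Fin d)))
    (hD : D = {x : EuclideanSpace ℝ (Fin d) | (∑ i, |x i|) ≤ 1})
    (hcurv : ∀ x ∈ D, ∀ s ∈ D, ∀ β ∈ Set.Icc (0:ℝ) 1,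
      f (x + β • (s - x)) ≤ f x + β * ⟪s - x, f' x⟫ + β ^ 2 / 2 * Cf)
    (xstar : EuclideanSpace ℝ (Fin d)) (hxstar : xstar ∈ D)
    (hmin : ∀ z ∈ D, f xstar ≤ f z)
    (x s : ℕ → EuclideanSpace ℝ (Fin d))
    (hx0 : x 0 ∈ D) (hs : ∀ t, s t ∈ D)
    (hlin : ∀ t : ℕ, ⟪s t, f' (x t)⟫ ≤ -(⨆ j, |f' (x t) j|) +
      Real.sqrt d * L * (Cf / (Real.sqrt d * L * ((t : ℝ) + 2))))
    (hupd : ∀ t : ℕ,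
      x (t + 1) = (1 - 2 / ((t : ℝ) + 2)) • x t + (2 / ((t : ℝ) + 2)) • s t) :
    (∀ t : ℕ, 1 ≤ t → f (x t) - f xstar ≤ 4 * Cf / ((t : ℝ) + 2)) ∧
    (∀ ε : ℝ, 0 < ε → ∀ T : ℕ, 1 ≤ T → 4 * Cf / ε - 2 ≤ (T : ℝ) →
      f (x T) - f xstar ≤ ε) := by
  have hγ : ∀ t : ℕ, 2 / ((t : ℝ) + 2) ∈ Set.Icc (0 : ℝ) 1 := fun t =>
    ⟨by positivity, by rw [div_le_one (by positivity)]; linarith [t.cast_nonneg (α := ℝ)]⟩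
  have hDconv : Convex ℝ D := hD ▸ EuclideanSpace.convex_setOf_sum_abs_le_one
  have hx : ∀ t, x t ∈ D := by
    intro t
    induction t with
    | zero => exact hx0
    | succ t ih =>
      rw [hupd t]
      exact hDconv ih (hs t) (by linarith [(hγ t).2]) (hγ t).1 (by ring)
  have hrec : ∀ t : ℕ, f (x (t + 1)) - f xstar ≤
      (1 - 2 / ((t : ℝ) + 2)) * (f (x t) - f xstar) + 4 * Cf / ((t : ℝ) + 2) ^ 2 := by
    intro t
    have hstep : x (t + 1) = x t + (2 / ((t : ℝ) + 2)) • (s t - x t) := by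
      rw [hupd t]; module
    have hc := hcurv (x t) (hx t) (s t) (hs t) _ (hγ t)
    rw [← hstep] at hc
    have hσ : Real.sqrt d * L * (Cf / (Real.sqrt d * L * ((t : ℝ) + 2))) =
        Cf / ((t : ℝ) + 2) := by
      have : 0 < Real.sqrt d := Real.sqrt_pos.2 (by exact_mod_cast hd)
      field_simp
    have hl := hlin t
    rw [hσ] at hl
    have hdual := EuclideanSpace.neg_iSup_abs_le_inner
      (show ∑ i, |xstar i| ≤ 1 by simpa [hD] using hxstar) (f' (x t))
    have htan := hconv.add_inner_le_of_hasGradientAt (hgrad (x t)) xstar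
    rw [inner_sub_left] at hc htan
    have hgap : ⟪s t, f' (x t)⟫ - ⟪x t, f' (x t)⟫ ≤
        f xstar - f (x t) + Cf / ((t : ℝ) + 2) := by linarith
    have hmul := mul_le_mul_of_nonneg_left hgap (hγ t).1
    have herr : 2 / ((t : ℝ) + 2) * (Cf / ((t : ℝ) + 2)) + (2 / ((t : ℝ) + 2)) ^ 2 / 2 * Cf =
        4 * Cf / ((t : ℝ) + 2) ^ 2 := by field_simp; ring
    linarith
  have hrate : ∀ t : ℕ, 1 ≤ t → f (x t) - f xstar ≤ 4 * Cf / ((t : ℝ) + 2) := fun t ht =>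
    le_four_mul_div_of_frankWolfe_recursion (h := fun t => f (x t) - f xstar) hCf.le hrec ht
  refine ⟨hrate, fun ε hε T hT hTε => (hrate T hT).trans ?_⟩
  rw [div_le_comm₀ (by positivity) hε]
  linarith
end

section
/- Let C_f ≥ 0 and let h : ℕ → ℝ satisfy h(t+1) ≤ (1 − 2/(t+2))·h(t) + (2/(t+2))²·C_f for all t ≥ 0. Then h(t) ≤ 4·C_f/(t+2) for all t ≥ 1. -/
theorem frank_wolfe_gap_recursion (Cf : ℝ) (hCf : 0 ≤ Cf) (h : ℕ → ℝ)
    (hrec : ∀ t : ℕ,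
      h (t + 1) ≤ (1 - 2 / ((t : ℝ) + 2)) * h t + (2 / ((t : ℝ) + 2)) ^ 2 * Cf) :
    ∀ t : ℕ, 1 ≤ t → h t ≤ 4 * Cf / ((t : ℝ) + 2) := by
  intro t ht
  induction t, ht using Nat.le_induction with
  | base =>
    have h0 := hrec 0
    norm_num at h0 ⊢
    linarith
  | succ t _ ih =>
    have ht0 : (0 : ℝ) ≤ t := t.cast_nonneg
    have hcoef : (0 : ℝ) ≤ 1 - 2 / ((t : ℝ) + 2) := by
      rw [sub_nonneg, div_le_one (by positivity)]
      linarith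
    calc h (t + 1)
        ≤ (1 - 2 / ((t : ℝ) + 2)) * h t + (2 / ((t : ℝ) + 2)) ^ 2 * Cf := hrec t
      _ ≤ (1 - 2 / ((t : ℝ) + 2)) * (4 * Cf / ((t : ℝ) + 2))
          + (2 / ((t : ℝ) + 2)) ^ 2 * Cf := by gcongr
      _ = 4 * Cf * ((t : ℝ) + 1) / ((t : ℝ) + 2) ^ 2 := by field_simp; ring
      _ ≤ 4 * Cf / (((t + 1 : ℕ) : ℝ) + 2) := by
        rw [div_le_div_iff₀ (by positivity) (by positivity), mul_assoc]
        push_cast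
        gcongr
        nlinarith
end

section
/- Let M ∈ ℝ^{d×d}, η ≥ 0, γ > 0, and let u, v, z_u, z_v ∈ ℝ^d be nonzero vectors with ‖u − z_u‖₂ ≤ η, ‖v − z_v‖₂ ≤ η, ‖z_u‖₂ ≥ γ and ‖z_v‖₂ ≥ γ. Then |uᵀM v/(‖u‖₂·‖v‖₂) − z_uᵀM z_v/(‖z_u‖₂·‖z_v‖₂)| ≤ 4·η·σ₁(M)/γ. -/
open scoped RealInnerProductSpace

/-- The largest singular value of a real matrix, i.e. its `ℓ₂ → ℓ₂` operator norm. -/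
noncomputable def sigma1 {d : ℕ} (M : Matrix (Fin d) (Fin d) ℝ) : ℝ :=
  ‖Matrix.toEuclideanCLM (𝕜 := ℝ) M‖

theorem norm_inv_smul_sub_inv_smul_le {E : Type*} [NormedAddCommGroup E] [NormedSpace ℝ E]
    {x y : E} (hx : x ≠ 0) (hy : y ≠ 0) :
    ‖‖x‖⁻¹ • x - ‖y‖⁻¹ • y‖ ≤ 2 * ‖x - y‖ / ‖y‖ := by
  have hx' : 0 < ‖x‖ := norm_pos_iff.2 hx
  have hy' : 0 < ‖y‖ := norm_pos_iff.2 hy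
  have key : ‖x‖⁻¹ • x - ‖y‖⁻¹ • y = ‖y‖⁻¹ • (x - y) + (‖x‖⁻¹ - ‖y‖⁻¹) • x := by
    module
  have hscal : ‖(‖x‖⁻¹ - ‖y‖⁻¹) • x‖ = |‖y‖ - ‖x‖| / ‖y‖ := by
    rw [norm_smul, Real.norm_eq_abs, ← abs_of_pos hx', ← abs_mul, abs_of_pos hx',
      ← abs_of_pos hy', ← abs_div, abs_of_pos hy']
    congr 1
    field_simp
  have hrev : |‖y‖ - ‖x‖| ≤ ‖x - y‖ := by
    rw [norm_sub_rev]
    exact abs_norm_sub_norm_le y x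
  calc ‖‖x‖⁻¹ • x - ‖y‖⁻¹ • y‖
      ≤ ‖‖y‖⁻¹ • (x - y)‖ + ‖(‖x‖⁻¹ - ‖y‖⁻¹) • x‖ := key ▸ norm_add_le _ _
    _ = ‖x - y‖ / ‖y‖ + |‖y‖ - ‖x‖| / ‖y‖ := by
      rw [hscal, norm_smul, norm_inv, norm_norm, inv_mul_eq_div]
    _ ≤ ‖x - y‖ / ‖y‖ + ‖x - y‖ / ‖y‖ := by gcongr
    _ = 2 * ‖x - y‖ / ‖y‖ := by ring

theorem abs_inner_clm_sub_le {E : Type*} [NormedAddCommGroup E] [InnerProductSpace ℝ E]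
    (A : E →L[ℝ] E) {a b a' b' : E} (hb : ‖b‖ ≤ 1) (ha' : ‖a'‖ ≤ 1) :
    |⟪a, A b⟫ - ⟪a', A b'⟫| ≤ (‖a - a'‖ + ‖b - b'‖) * ‖A‖ := by
  have key : ⟪a, A b⟫ - ⟪a', A b'⟫ = ⟪a - a', A b⟫ + ⟪a', A (b - b')⟫ := by
    rw [inner_sub_left, map_sub, inner_sub_right]
    ring
  rw [key]
  calc |⟪a - a', A b⟫ + ⟪a', A (b - b')⟫|
      ≤ |⟪a - a', A b⟫| + |⟪a', A (b - b')⟫| := abs_add_le _ _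
    _ ≤ ‖a - a'‖ * ‖A b‖ + ‖a'‖ * ‖A (b - b')‖ :=
      add_le_add (abs_real_inner_le_norm _ _) (abs_real_inner_le_norm _ _)
    _ ≤ ‖a - a'‖ * (‖A‖ * 1) + 1 * (‖A‖ * ‖b - b'‖) := by
      gcongr
      · exact A.le_opNorm_of_le hb
      · exact A.le_opNorm _
    _ = (‖a - a'‖ + ‖b - b'‖) * ‖A‖ := by ring

theorem normalized_bilinear_perturbation {d : ℕ} (M : Matrix (Fin d) (Fin d) ℝ)
    (η γ : ℝ) (hη : 0 ≤ η) (hγ : 0 < γ)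
    (u v zu zv : EuclideanSpace ℝ (Fin d))
    (hu : u ≠ 0) (hv : v ≠ 0) (hzu : zu ≠ 0) (hzv : zv ≠ 0)
    (h1 : ‖u - zu‖ ≤ η) (h2 : ‖v - zv‖ ≤ η)
    (h3 : γ ≤ ‖zu‖) (h4 : γ ≤ ‖zv‖) :
    |⟪u, Matrix.toEuclideanCLM (𝕜 := ℝ) M v⟫ / (‖u‖ * ‖v‖) -
      ⟪zu, Matrix.toEuclideanCLM (𝕜 := ℝ) M zv⟫ / (‖zu‖ * ‖zv‖)|
      ≤ 4 * η * sigma1 M / γ := by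
  have hnorm : ∀ {x : EuclideanSpace ℝ (Fin d)}, x ≠ 0 → ‖‖x‖⁻¹ • x‖ ≤ 1 := fun hx => by
    rw [norm_smul, norm_inv, norm_norm, inv_mul_cancel₀ (norm_ne_zero_iff.2 hx)]
  have hinner : ∀ x y : EuclideanSpace ℝ (Fin d),
      ⟪x, Matrix.toEuclideanCLM (𝕜 := ℝ) M y⟫ / (‖x‖ * ‖y‖) =
        ⟪‖x‖⁻¹ • x, Matrix.toEuclideanCLM (𝕜 := ℝ) M (‖y‖⁻¹ • y)⟫ := fun x y => by
    rw [map_smul, real_inner_smul_left, real_inner_smul_right, div_eq_mul_inv, mul_inv]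
    ring
  have hdist : ∀ {x y : EuclideanSpace ℝ (Fin d)}, x ≠ 0 → y ≠ 0 → ‖x - y‖ ≤ η → γ ≤ ‖y‖ →
      ‖‖x‖⁻¹ • x - ‖y‖⁻¹ • y‖ ≤ 2 * η / γ := fun hx hy hxy hγy =>
    (norm_inv_smul_sub_inv_smul_le hx hy).trans (by gcongr)
  rw [hinner, hinner, sigma1]
  calc _ ≤ _ := abs_inner_clm_sub_le _ (hnorm hv) (hnorm hzu)
    _ ≤ (2 * η / γ + 2 * η / γ) * ‖Matrix.toEuclideanCLM (𝕜 := ℝ) M‖ := by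
      gcongr
      · exact hdist hu hzu h1 h3
      · exact hdist hv hzv h2 h4
    _ = 4 * η * ‖Matrix.toEuclideanCLM (𝕜 := ℝ) M‖ / γ := by ring
end
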